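/- Let V be a finite-dimensional real vector space, C ⊆ V a compact convex set, and E its set of extreme points; assume E is closed. Let E₀ ⊆ E be a compact subset, c ∈ ℝ, and f : E → ℝ a continuous function with f(x) = c for all x ∈ E₀ and f(x) > c for all x ∈ E \ E₀. Then for every x ∈ C, the convex roof satisfies f^∪(x) = c if and only if x belongs to the convex hull conv(E₀). -/

import Mathlib

open scoped BigOperators

/-- The convex roof extension of `f` relative to the set `E`:
`f^∪(x) = inf { ∑ p_k f(x_k) : p_k ≥ 0, ∑ p_k = 1, x_k ∈ E, ∑ p_k x_k = x }`. -/
noncomputable def convexRoof {V : Type*} [AddCommGroup V] [Module ℝ V]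
    (E : Set V) (f : V → ℝ) (x : V) : ℝ :=
  sInf { r : ℝ | ∃ (n : ℕ) (p : Fin n → ℝ) (y : Fin n → V),
    (∀ i, 0 ≤ p i) ∧ (∑ i, p i) = 1 ∧ (∀ i, y i ∈ E) ∧
    (∑ i, p i • y i) = x ∧ r = ∑ i, p i * f (y i) }

/-- A point of a convex hull is a convex combination of points indexed by some `Fin n`. -/
theorem mem_convexHull_iff_exists_fin {W : Type*} [AddCommGroup W] [Module ℝ W]
    {s : Set W} {x : W} :
    x ∈ convexHull ℝ s ↔ ∃ (n : ℕ) (p : Fin n → ℝ) (y : Fin n → W),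
      (∀ i, 0 ≤ p i) ∧ ∑ i, p i = 1 ∧ (∀ i, y i ∈ s) ∧ ∑ i, p i • y i = x := by
  constructor
  · intro hx
    obtain ⟨ι, _, w, z, hw₀, hw₁, hz, hx⟩ := mem_convexHull_iff_exists_fintype.1 hx
    let e := (Fintype.equivFin ι).symm
    exact ⟨Fintype.card ι, w ∘ e, z ∘ e, fun i => hw₀ _, (e.sum_comp w).trans hw₁,
      fun i => hz _, (e.sum_comp fun i => w i • z i).trans hx⟩
  · rintro ⟨n, p, y, hp₀, hp₁, hy, hx⟩
    exact mem_convexHull_of_exists_fintype p y hp₀ hp₁ hy hx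

/-- In a finite-dimensional space, the convex hull of a compact set is compact. -/
theorem IsCompact.convexHull_of_finiteDimensional {W : Type*} [NormedAddCommGroup W]
    [NormedSpace ℝ W] [FiniteDimensional ℝ W] {s : Set W} (hs : IsCompact s) :
    IsCompact (convexHull ℝ s) := by
  have hunion : convexHull ℝ s = ⋃ k : Fin (Module.finrank ℝ W + 2),
      (fun q : (Fin k → ℝ) × (Fin k → W) => ∑ i, q.1 i • q.2 i) ''
        (stdSimplex ℝ (Fin k) ×ˢ Set.univ.pi fun _ => s) := by
    ext x
    simp only [Set.mem_iUnion, Set.mem_image, Set.mem_prod, Set.mem_univ_pi, Prod.exists]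
    constructor
    · intro hx
      obtain ⟨ι, _, z, w, hz, hind, hw₀, hw₁, rfl⟩ := eq_pos_convex_span_of_mem_convexHull hx
      have hcard : Fintype.card ι ≤ Module.finrank ℝ W + 1 :=
        hind.card_le_finrank_succ.trans (Nat.succ_le_succ (Submodule.finrank_le _))
      let e := (Fintype.equivFin ι).symm
      exact ⟨⟨Fintype.card ι, by omega⟩, w ∘ e, z ∘ e,
        ⟨⟨fun i => (hw₀ _).le, (e.sum_comp w).trans hw₁⟩, fun i => hz ⟨_, rfl⟩⟩,
        e.sum_comp fun i => w i • z i⟩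
    · rintro ⟨k, w, z, ⟨⟨hw₀, hw₁⟩, hz⟩, hx⟩
      exact mem_convexHull_of_exists_fintype w z hw₀ hw₁ hz hx
  rw [hunion]
  refine isCompact_iUnion fun k => ?_
  refine ((isCompact_stdSimplex ℝ (Fin k)).prod (isCompact_univ_pi fun _ => hs)).image ?_
  fun_prop

/-- The values competing in the convex roof at `x` form the fibre over `x` of the convex hull of
the graph. -/
theorem setOf_convexRoof_eq {V : Type*} [AddCommGroup V] [Module ℝ V]
    (E : Set V) (f : V → ℝ) (x : V) :
    { r : ℝ | ∃ (n : ℕ) (p : Fin n → ℝ) (y : Fin n → V),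
      (∀ i, 0 ≤ p i) ∧ (∑ i, p i) = 1 ∧ (∀ i, y i ∈ E) ∧
      (∑ i, p i • y i) = x ∧ r = ∑ i, p i * f (y i) } =
      {r : ℝ | (x, r) ∈ convexHull ℝ ((fun y => (y, f y)) '' E)} := by
  ext r
  simp only [Set.mem_ofPred_eq, mem_convexHull_iff_exists_fin]
  constructor
  · rintro ⟨n, p, y, hp₀, hp₁, hy, hx, hr⟩
    refine ⟨n, p, fun i => (y i, f (y i)), hp₀, hp₁, fun i => ⟨y i, hy i, rfl⟩, ?_⟩
    ext <;> simp [Prod.fst_sum, Prod.snd_sum, hx, hr]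
  · rintro ⟨n, p, z, hp₀, hp₁, hz, hxr⟩
    choose y hy hyz using hz
    obtain rfl : (fun i => (y i, f (y i))) = z := funext hyz
    refine ⟨n, p, y, hp₀, hp₁, hy, ?_, ?_⟩
    · simpa [Prod.fst_sum] using congrArg Prod.fst hxr
    · simpa [Prod.snd_sum] using (congrArg Prod.snd hxr).symm

/-- A convex combination of points of `E` at which the average of `f` is its minimum `c` is a
convex combination of minimisers. -/
theorem mem_convexHull_of_sum_eq_min {V ι : Type*} [AddCommGroup V] [Module ℝ V] [Fintype ι]
    {E E₀ : Set V} {c : ℝ} {f : V → ℝ}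
    (hfc : ∀ x ∈ E₀, f x = c) (hfgt : ∀ x ∈ E \ E₀, c < f x)
    {p : ι → ℝ} {y : ι → V} (hp₀ : ∀ i, 0 ≤ p i) (hp₁ : ∑ i, p i = 1) (hy : ∀ i, y i ∈ E)
    (hsum : ∑ i, p i * f (y i) = c) : ∑ i, p i • y i ∈ convexHull ℝ E₀ := by
  have hmin : ∀ i, c ≤ f (y i) := fun i => by
    by_cases h : y i ∈ E₀
    · exact (hfc _ h).ge
    · exact (hfgt _ ⟨hy i, h⟩).le
  have hzero : ∑ i, p i * (f (y i) - c) = 0 := by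
    simp [mul_sub, Finset.sum_sub_distrib, ← Finset.sum_mul, hsum, hp₁]
  rw [Finset.sum_eq_zero_iff_of_nonneg
    fun i _ => mul_nonneg (hp₀ i) (sub_nonneg.2 (hmin i))] at hzero
  have hmem : ∀ i, p i ≠ 0 → y i ∈ E₀ := fun i hi => by
    by_contra h
    have hlt := hfgt _ ⟨hy i, h⟩
    rcases mul_eq_zero.1 (hzero i (Finset.mem_univ i)) with h' | h'
    · exact hi h'
    · linarith
  rw [← Finset.centerMass_eq_of_sum_1 _ _ hp₁, ← Finset.centerMass_filter_ne_zero]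
  refine Finset.centerMass_mem_convexHull _ (fun i _ => hp₀ i) ?_ ?_
  · rw [Finset.sum_filter_ne_zero, hp₁]
    exact one_pos
  · intro i hi
    exact hmem i (Finset.mem_filter.1 hi).2

/-- If `f` is continuous on the (closed) set of extreme points `E` of a compact convex
set `C`, equals `c` on a compact subset `E₀ ⊆ E` and is `> c` on `E \ E₀`, then for
`x ∈ C` the convex roof satisfies `f^∪(x) = c` iff `x ∈ conv(E₀)`. -/
theorem convexRoof_eq_iff_mem_convexHull
    {V : Type*} [NormedAddCommGroup V] [NormedSpace ℝ V] [FiniteDimensional ℝ V]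
    (C : Set V) (hCcompact : IsCompact C) (hCconvex : Convex ℝ C)
    (E : Set V) (hE : E = Set.extremePoints ℝ C) (hEclosed : IsClosed E)
    (E₀ : Set V) (hE₀ : E₀ ⊆ E) (hE₀compact : IsCompact E₀)
    (c : ℝ) (f : V → ℝ) (hf : ContinuousOn f E)
    (hfc : ∀ x ∈ E₀, f x = c) (hfgt : ∀ x ∈ E \ E₀, c < f x) :
    ∀ x ∈ C, (convexRoof E f x = c ↔ x ∈ convexHull ℝ E₀) := by
  intro x hx
  have hEcompact : IsCompact E :=
    hCcompact.of_isClosed_subset hEclosed (hE ▸ extremePoints_subset)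
  have hxE : x ∈ convexHull ℝ E := by
    rw [← hEcompact.convexHull_of_finiteDimensional.isClosed.closure_eq, hE,
      closure_convexHull_extremePoints hCcompact hCconvex]
    exact hx
  have hmin : ∀ y ∈ E, c ≤ f y := fun y hy => by
    by_cases h : y ∈ E₀
    · exact (hfc _ h).ge
    · exact (hfgt _ ⟨hy, h⟩).le
  set R : Set ℝ := { r : ℝ | ∃ (n : ℕ) (p : Fin n → ℝ) (y : Fin n → V),
    (∀ i, 0 ≤ p i) ∧ (∑ i, p i) = 1 ∧ (∀ i, y i ∈ E) ∧
    (∑ i, p i • y i) = x ∧ r = ∑ i, p i * f (y i) } with hR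
  have hlb : c ∈ lowerBounds R := by
    rintro r ⟨n, p, y, hp₀, hp₁, hy, -, rfl⟩
    calc c = ∑ i, p i * c := by rw [← Finset.sum_mul, hp₁, one_mul]
      _ ≤ ∑ i, p i * f (y i) :=
        Finset.sum_le_sum fun i _ => mul_le_mul_of_nonneg_left (hmin _ (hy i)) (hp₀ i)
  constructor
  · intro hroof
    have hclosed : IsClosed R := by
      rw [hR, setOf_convexRoof_eq]
      have hgraph : IsCompact ((fun y => (y, f y)) '' E) :=
        hEcompact.image_of_continuousOn (continuousOn_id.prodMk hf)
      exact hgraph.convexHull_of_finiteDimensional.isClosed.preimage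
        (Continuous.prodMk_right x)
    have hne : R.Nonempty := by
      obtain ⟨n, p, y, hp₀, hp₁, hy, hxy⟩ := mem_convexHull_iff_exists_fin.1 hxE
      exact ⟨_, n, p, y, hp₀, hp₁, hy, hxy, rfl⟩
    have hcR : c ∈ R := hroof ▸ hclosed.csInf_mem hne ⟨c, hlb⟩
    obtain ⟨n, p, y, hp₀, hp₁, hy, rfl, hc⟩ := hcR
    exact mem_convexHull_of_sum_eq_min hfc hfgt hp₀ hp₁ hy hc.symm
  · intro hx₀
    obtain ⟨n, p, y, hp₀, hp₁, hy, hxy⟩ := mem_convexHull_iff_exists_fin.1 hx₀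
    refine IsLeast.csInf_eq ⟨⟨n, p, y, hp₀, hp₁, fun i => hE₀ (hy i), hxy, ?_⟩, hlb⟩
    simp only [hfc _ (hy _), ← Finset.sum_mul, hp₁, one_mul]
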